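/- The space of sl_2-invariant linear maps ω: a → g_2 from the abelian ideal a of g_2 = sch_2/⟨z⟩ has dimension 4; concretely, ω is sl_2-invariant if and only if there exist scalars α_1, α_2, α_3, α_4 with ω(x_1)=α_1x_1+α_2x_2, ω(x_2)=α_3x_1+α_4x_2, ω(y_1)=α_1y_1+α_2y_2, ω(y_2)=α_3y_1+α_4y_2. -/

import Mathlib

open scoped BigOperators

/-- Basis index set for the Lie algebra `g_n = sch_n/⟨z⟩`, the quotient of the `n`-th
Schrödinger algebra by its center, with basis `{h, e, f, x_1, …, x_n, y_1, …, y_n}`. -/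
inductive GIdx (n : ℕ) : Type
  | H : GIdx n
  | E : GIdx n
  | F : GIdx n
  | X : Fin n → GIdx n
  | Y : Fin n → GIdx n
  deriving DecidableEq

/-- The underlying vector space of `g_n = sch_n/⟨z⟩`. -/
abbrev G (n : ℕ) : Type := GIdx n → ℂ

/-- The Lie bracket of `g_n`, componentwise; it encodes exactly the relations
`[e,f]=h, [h,e]=2e, [h,f]=-2f, [h,x_i]=x_i, [h,y_i]=-y_i, [e,y_i]=x_i, [f,x_i]=y_i`. -/
noncomputable def brg {n : ℕ} (u v : G n) : G n := fun j =>
  match j with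
  | .H => u .E * v .F - u .F * v .E
  | .E => 2 * (u .H * v .E - u .E * v .H)
  | .F => -2 * (u .H * v .F - u .F * v .H)
  | .X i => (u .H * v (.X i) - u (.X i) * v .H) + (u .E * v (.Y i) - u (.Y i) * v .E)
  | .Y i => -(u .H * v (.Y i) - u (.Y i) * v .H) + (u .F * v (.X i) - u (.X i) * v .F)

/-- The bracket of `g_n` as a bilinear map. -/
noncomputable def brgL (n : ℕ) : G n →ₗ[ℂ] G n →ₗ[ℂ] G n :=
  LinearMap.mk₂ ℂ brg
    (by intro m m' v; funext j; cases j <;> simp only [brg, Pi.add_apply] <;> ring)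
    (by intro c m v; funext j; cases j <;>
      simp only [brg, Pi.smul_apply, smul_eq_mul] <;> ring)
    (by intro m v v'; funext j; cases j <;> simp only [brg, Pi.add_apply] <;> ring)
    (by intro c m v; funext j; cases j <;>
      simp only [brg, Pi.smul_apply, smul_eq_mul] <;> ring)

/-- The basis vector `h` of `g_n`. -/
noncomputable def hG (n : ℕ) : G n := Pi.single GIdx.H 1
/-- The basis vector `e` of `g_n`. -/
noncomputable def eG (n : ℕ) : G n := Pi.single GIdx.E 1
/-- The basis vector `f` of `g_n`. -/
noncomputable def fG (n : ℕ) : G n := Pi.single GIdx.F 1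
/-- The basis vector `x_i` of `g_n`. -/
noncomputable def xG {n : ℕ} (i : Fin n) : G n := Pi.single (GIdx.X i) 1
/-- The basis vector `y_i` of `g_n`. -/
noncomputable def yG {n : ℕ} (i : Fin n) : G n := Pi.single (GIdx.Y i) 1

/-- The subalgebra `sl_2 = span {e, f, h}` of `g_n`. -/
noncomputable def sl2G (n : ℕ) : Submodule ℂ (G n) :=
  Submodule.span ℂ {eG n, fG n, hG n}

/-- Basis index set for the abelian ideal `a = span {x_1, …, x_n, y_1, …, y_n}` of `g_n`. -/
inductive AIdx (n : ℕ) : Type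
  | X : Fin n → AIdx n
  | Y : Fin n → AIdx n
  deriving DecidableEq

/-- The underlying vector space of the abelian ideal `a` of `g_n`. -/
abbrev A (n : ℕ) : Type := AIdx n → ℂ

/-- The natural inclusion `a → g_n`. -/
noncomputable def ιA {n : ℕ} (a : A n) : G n := fun j =>
  match j with
  | .X i => a (.X i)
  | .Y i => a (.Y i)
  | .H => 0
  | .E => 0
  | .F => 0

/-- The action of `v ∈ g_n` on the ideal `a`: `actA v a = [v, a]`, viewed inside `a`
(the ideal `a` is stable under taking brackets with any element). -/
noncomputable def actA {n : ℕ} (v : G n) (a : A n) : A n := fun j =>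
  match j with
  | .X i => brgL n v (ιA a) (GIdx.X i)
  | .Y i => brgL n v (ιA a) (GIdx.Y i)

/-- The (zero) bracket of the abelian ideal `a`. -/
noncomputable def brA {n : ℕ} (a b : A n) : A n := actA (ιA a) b

/-- The basis vector `x_i` of `a`. -/
noncomputable def xA {n : ℕ} (i : Fin n) : A n := Pi.single (AIdx.X i) 1
/-- The basis vector `y_i` of `a`. -/
noncomputable def yA {n : ℕ} (i : Fin n) : A n := Pi.single (AIdx.Y i) 1
/-- The space of `sl_2`-invariant linear maps `ω : a → g_n`, i.e. those with
`[v, ω(a)] = ω([v,a])` for all `v ∈ sl_2` and `a ∈ a`. -/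
noncomputable def invHomA (n : ℕ) : Submodule ℂ (A n →ₗ[ℂ] G n) where
  carrier := {ω | ∀ v ∈ sl2G n, ∀ a, brgL n v (ω a) = ω (actA v a)}
  add_mem' := by
    rintro ω σ hω hσ v hv a
    simp only [LinearMap.add_apply, map_add, hω v hv a, hσ v hv a]
  zero_mem' := by intro v hv a; simp
  smul_mem' := by
    rintro c ω hω v hv a
    simp only [LinearMap.smul_apply, map_smul, hω v hv a]

/-- The index set of the basis of `a` consists of two copies of `Fin n`. -/
def AIdx.equivSum (n : ℕ) : AIdx n ≃ Fin n ⊕ Fin n where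
  toFun
    | .X i => Sum.inl i
    | .Y i => Sum.inr i
  invFun := Sum.elim AIdx.X AIdx.Y
  left_inv j := by cases j <;> rfl
  right_inv j := by cases j <;> rfl

instance AIdx.instFinite (n : ℕ) : Finite (AIdx n) :=
  Finite.of_equiv _ (AIdx.equivSum n).symm

/-- Linear maps out of `a` agree if they agree on the basis vectors `x_i` and `y_i`. -/
theorem A.linearMap_ext {n : ℕ} {ω σ : A n →ₗ[ℂ] G n} (hx : ∀ i, ω (xA i) = σ (xA i))
    (hy : ∀ i, ω (yA i) = σ (yA i)) : ω = σ := by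
  refine LinearMap.pi_ext' fun j => LinearMap.ext_ring ?_
  cases j with
  | X i => exact hx i
  | Y i => exact hy i

/-- Elements of `sl_2` have no component along `x_i` or `y_i`. -/
theorem apply_eq_zero_of_mem_sl2G {n : ℕ} {v : G n} (hv : v ∈ sl2G n) (i : Fin n) :
    v (.X i) = 0 ∧ v (.Y i) = 0 := by
  induction hv using Submodule.span_induction with
  | mem v hv => rcases hv with rfl | rfl | rfl <;> simp [eG, fG, hG]
  | zero => simp
  | add u v _ _ hu hv => simp [hu, hv]
  | smul c v _ hv => simp [hv]

/-- The linear map `a → g_n` with `x_i ↦ ∑ j, M i j x_j` and `y_i ↦ ∑ j, M i j y_j`. -/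
noncomputable def matrixHom (n : ℕ) : Matrix (Fin n) (Fin n) ℂ →ₗ[ℂ] A n →ₗ[ℂ] G n :=
  LinearMap.mk₂ ℂ
    (fun M a j => match j with
      | .X j => ∑ i, a (.X i) * M i j
      | .Y j => ∑ i, a (.Y i) * M i j
      | .H => 0
      | .E => 0
      | .F => 0)
    (by intro M N a; funext j; cases j <;> simp [mul_add, Finset.sum_add_distrib])
    (by intro c M a; funext j; cases j <;> simp [Finset.mul_sum, mul_left_comm])
    (by intro M a b; funext j; cases j <;> simp [add_mul, Finset.sum_add_distrib])
    (by intro c M a; funext j; cases j <;> simp [Finset.mul_sum, mul_assoc])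

theorem matrixHom_xA {n : ℕ} (M : Matrix (Fin n) (Fin n) ℂ) (i : Fin n) :
    matrixHom n M (xA i) = ∑ j, M i j • xG j := by
  funext k
  cases k <;> simp [matrixHom, xA, xG, Pi.single_apply]

theorem matrixHom_yA {n : ℕ} (M : Matrix (Fin n) (Fin n) ℂ) (i : Fin n) :
    matrixHom n M (yA i) = ∑ j, M i j • yG j := by
  funext k
  cases k <;> simp [matrixHom, yA, yG, Pi.single_apply]

theorem matrixHom_injective (n : ℕ) : Function.Injective (matrixHom n) := by
  intro M N h
  ext i j
  have := congrFun (congrArg (fun ω => ω (xA i)) h) (.X j)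
  simpa [matrixHom_xA, xG, Pi.single_apply] using this

theorem matrixHom_mem_invHomA {n : ℕ} (M : Matrix (Fin n) (Fin n) ℂ) :
    matrixHom n M ∈ invHomA n := by
  intro v hv a
  have hv0 := apply_eq_zero_of_mem_sl2G hv
  funext k
  cases k <;>
    simp [matrixHom, brgL, brg, actA, ιA, hv0, add_mul, Finset.sum_add_distrib,
      Finset.mul_sum, mul_assoc]

theorem eq_matrixHom_of_mem_invHomA {n : ℕ} {ω : A n →ₗ[ℂ] G n} (hω : ω ∈ invHomA n) :
    ω = matrixHom n (Matrix.of fun i j => ω (xA i) (.X j)) := by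
  have hx : ∀ i, ω (xA i) = ∑ j, ω (xA i) (.X j) • xG j := by
    intro i
    have h := hω (hG n) (Submodule.subset_span (by simp)) (xA i)
    have hact : actA (hG n) (xA i) = xA i := by
      funext k
      cases k <;> simp [actA, brgL, brg, ιA, hG, xA, Pi.single_apply]
    rw [hact] at h
    funext k
    have hk := congrFun h k
    cases k <;> simp [brgL, brg, hG, xG, Pi.single_apply] at hk ⊢
    · exact hk.symm
    all_goals grind
  refine A.linearMap_ext (fun i => ?_) fun i => ?_
  · simpa only [matrixHom_xA, Matrix.of_apply] using hx i
  have hact : actA (fG n) (xA i) = yA i := by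
    funext k
    cases k <;> simp [actA, brgL, brg, ιA, fG, xA, yA, Pi.single_apply]
  have hbr : ∀ j, brgL n (fG n) (xG j) = yG j := by
    intro j
    funext k
    cases k <;> simp [brgL, brg, fG, xG, yG, Pi.single_apply]
  rw [← hact, ← hω (fG n) (Submodule.subset_span (by simp)) (xA i), hx i, hact, matrixHom_yA]
  simp only [map_sum, map_smul, hbr, Matrix.of_apply]

theorem range_matrixHom (n : ℕ) : LinearMap.range (matrixHom n) = invHomA n := by
  ext ω
  refine ⟨?_, fun hω => ⟨_, (eq_matrixHom_of_mem_invHomA hω).symm⟩⟩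
  rintro ⟨M, rfl⟩
  exact matrixHom_mem_invHomA M

theorem finrank_invHomA (n : ℕ) : Module.finrank ℂ (invHomA n) = n * n := by
  rw [← range_matrixHom, LinearMap.finrank_range_of_inj (matrixHom_injective n)]
  simp [Module.finrank_matrix]

/-- **The space of `sl_2`-invariant linear maps `ω : a → g_2` has dimension `4`;
concretely, `ω` is `sl_2`-invariant iff there are scalars `α_1, α_2, α_3, α_4` with
`ω(x_1) = α_1x_1 + α_2x_2`, `ω(x_2) = α_3x_1 + α_4x_2`, `ω(y_1) = α_1y_1 + α_2y_2`,
`ω(y_2) = α_3y_1 + α_4y_2`.** -/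
theorem invHomA_two_description :
    Module.finrank ℂ ↥(invHomA 2) = 4 ∧
      ∀ ω : A 2 →ₗ[ℂ] G 2,
        (ω ∈ invHomA 2 ↔
          ∃ α₁ α₂ α₃ α₄ : ℂ,
            ω (xA 0) = α₁ • xG 0 + α₂ • xG 1 ∧
            ω (xA 1) = α₃ • xG 0 + α₄ • xG 1 ∧
            ω (yA 0) = α₁ • yG 0 + α₂ • yG 1 ∧
            ω (yA 1) = α₃ • yG 0 + α₄ • yG 1) := by
  refine ⟨by rw [finrank_invHomA], fun ω => ⟨fun hω => ?_, ?_⟩⟩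
  · rw [← range_matrixHom] at hω
    obtain ⟨M, rfl⟩ := hω
    refine ⟨M 0 0, M 0 1, M 1 0, M 1 1, ?_, ?_, ?_, ?_⟩ <;>
      simp only [matrixHom_xA, matrixHom_yA, Fin.sum_univ_two]
  · rintro ⟨α₁, α₂, α₃, α₄, hx0, hx1, hy0, hy1⟩
    suffices h : ω = matrixHom 2 !![α₁, α₂; α₃, α₄] from h ▸ matrixHom_mem_invHomA _
    refine A.linearMap_ext (fun i => ?_) fun i => ?_
    · fin_cases i <;> simp [matrixHom_xA, hx0, hx1]
    · fin_cases i <;> simp [matrixHom_yA, hy0, hy1]
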